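/- (Law of total cumulance) Let (Ω, P) = (Ω₁, P₁) × (Ω₂, P₂) be a product probability space, and let X be a bounded random variable on Ω. Then for all m ≥ 2, κ^m[X] = Σ_{π ⊢ {1,...,m}} κ₁^{#π}[(κ₂^{#A}[X])_{A ∈ π}], where κ denotes cumulants with respect to P, κ₂^{#A}[X] is the cumulant of order #A of X with respect to P₂ (a random variable on Ω₁), and κ₁ denotes joint cumulants with respect to P₁. -/

import Mathlib

open MeasureTheory

/-- The `m`-th cumulant of a (bounded) random variable:
the `m`-th derivative of `log E[e^{tX}]` at `t = 0`. -/
noncomputable def cumulant {Ω : Type*} [MeasurableSpace Ω] (μ : Measure Ω) (X : Ω → ℝ)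
    (m : ℕ) : ℝ :=
  iteratedDeriv m (fun t : ℝ => Real.log (∫ ω, Real.exp (t * X ω) ∂μ)) 0

/-- The joint cumulant of a finite family of (bounded) random variables: the mixed partial
derivative `∂_{t₁} ⋯ ∂_{t_k}` of `log E[exp (∑ⱼ tⱼ Xⱼ)]` at `t = 0`. -/
noncomputable def jointCumulant {Ω : Type*} [MeasurableSpace Ω] {ι : Type*} [Fintype ι]
    [DecidableEq ι] (μ : Measure Ω) (X : ι → Ω → ℝ) : ℝ :=
  iteratedFDeriv ℝ (Fintype.card ι)
    (fun t : ι → ℝ => Real.log (∫ ω, Real.exp (∑ j, t j * X j ω) ∂μ)) 0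
    (fun k => Pi.single ((Fintype.equivFin ι).symm k) 1)

namespace OrderedFinpartition

variable {n : ℕ}

/-- The `i`-th part of an ordered finpartition, as a finset. -/
def part (c : OrderedFinpartition n) (i : Fin c.length) : Finset (Fin n) :=
  Finset.univ.map ⟨c.emb i, (c.emb_strictMono i).injective⟩

lemma coe_part (c : OrderedFinpartition n) (i : Fin c.length) :
    (c.part i : Set (Fin n)) = Set.range (c.emb i) := by
  simp [part]

lemma mem_part (c : OrderedFinpartition n) (i : Fin c.length) (x : Fin n) :
    x ∈ c.part i ↔ x ∈ Set.range (c.emb i) := by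
  rw [← coe_part, Finset.mem_coe]

lemma card_part (c : OrderedFinpartition n) (i : Fin c.length) :
    (c.part i).card = c.partSize i := by
  simp [part]

lemma eq_of_mem_part (c : OrderedFinpartition n) {i j : Fin c.length} {x : Fin n}
    (hi : x ∈ c.part i) (hj : x ∈ c.part j) : i = j := by
  by_contra h
  rw [mem_part] at hi hj
  exact Set.disjoint_left.1 (c.disjoint (Set.mem_univ i) (Set.mem_univ j) h) hi hj

lemma exists_mem_part (c : OrderedFinpartition n) (x : Fin n) : ∃ i, x ∈ c.part i := by
  simpa only [mem_part] using c.cover x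

/-- The greatest element of the `i`-th part of an ordered finpartition. -/
def top (c : OrderedFinpartition n) (i : Fin c.length) : Fin n :=
  c.emb i ⟨c.partSize i - 1, Nat.sub_one_lt_of_lt (c.partSize_pos i)⟩

lemma top_mem_part (c : OrderedFinpartition n) (i : Fin c.length) : c.top i ∈ c.part i :=
  (c.mem_part i _).2 ⟨_, rfl⟩

lemma le_top (c : OrderedFinpartition n) {i : Fin c.length} {x : Fin n} (hx : x ∈ c.part i) :
    x ≤ c.top i := by
  obtain ⟨j, rfl⟩ := (c.mem_part i x).1 hx
  exact (c.emb_strictMono i).monotone (Fin.le_def.2 (Nat.le_sub_one_of_lt j.2))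

lemma part_injective (c : OrderedFinpartition n) : Function.Injective c.part :=
  fun i _ h => c.eq_of_mem_part (c.top_mem_part i) (h ▸ c.top_mem_part i)

/-- The unordered partition underlying an ordered finpartition. -/
def toFinpartition (c : OrderedFinpartition n) :
    Finpartition (Finset.univ : Finset (Fin n)) where
  parts := Finset.univ.map ⟨c.part, c.part_injective⟩
  supIndep := by
    rw [Finset.supIndep_iff_pairwiseDisjoint]
    intro a ha b hb hab
    simp only [Finset.coe_map, Finset.coe_univ, Set.image_univ, Set.mem_range] at ha hb
    obtain ⟨i, rfl⟩ := ha
    obtain ⟨j, rfl⟩ := hb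
    refine Finset.disjoint_left.2 fun x hi hj => hab ?_
    rw [c.eq_of_mem_part hi hj]
  sup_parts := by
    refine Finset.eq_univ_iff_forall.2 fun x => ?_
    obtain ⟨i, hi⟩ := c.exists_mem_part x
    exact Finset.mem_sup.2 ⟨c.part i, by simp, hi⟩
  bot_notMem := by
    simp only [Finset.mem_map, not_exists]
    rintro i ⟨-, h⟩
    have := c.top_mem_part i
    simp_all

lemma mem_toFinpartition_parts (c : OrderedFinpartition n) (s : Finset (Fin n)) :
    s ∈ c.toFinpartition.parts ↔ ∃ i, c.part i = s := by
  simp [toFinpartition]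

lemma eq_of_part_eq {c d : OrderedFinpartition n} (hl : c.length = d.length)
    (h : ∀ i, c.part i = d.part (Fin.cast hl i)) : c = d := by
  have hsize : ∀ i, c.partSize i = d.partSize (Fin.cast hl i) := fun i => by
    rw [← card_part, h, card_part]
  have hrange : ∀ i, Set.range (c.emb i) = Set.range (d.emb (Fin.cast hl i)) := fun i => by
    rw [← coe_part, h, coe_part]
  obtain ⟨l, p, hp, e, he, hs, hd, hc⟩ := c
  obtain ⟨l', p', hp', e', he', hs', hd', hc'⟩ := d
  dsimp only at hl
  subst hl
  obtain rfl : p = p' := funext hsize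
  obtain rfl : e = e' := funext fun i => (StrictMono.range_inj (he i) (he' i)).1 (hrange i)
  rfl

lemma toFinpartition_injective :
    Function.Injective (toFinpartition : OrderedFinpartition n → _) := by
  intro c d h
  have hcard : ∀ c : OrderedFinpartition n, c.toFinpartition.parts.card = c.length := fun c => by
    simp [toFinpartition]
  have hl : c.length = d.length := by rw [← hcard, h, hcard]
  have key : ∀ {c d : OrderedFinpartition n}, c.toFinpartition = d.toFinpartition →
      ∀ i, ∃ j, d.part j = c.part i := fun {c d} h i => by
    rw [← mem_toFinpartition_parts, ← h, mem_toFinpartition_parts]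
    exact ⟨i, rfl⟩
  have htop : ∀ {c d : OrderedFinpartition n} {i j}, d.part j = c.part i →
      d.top j = c.top i := fun {c d i j} h =>
    le_antisymm (c.le_top (h ▸ d.top_mem_part j)) (d.le_top (h ▸ c.top_mem_part i))
  have hmono : ∀ c : OrderedFinpartition n, StrictMono c.top := fun c => c.parts_strictMono
  have htops : c.top = d.top ∘ Fin.cast hl := by
    refine (StrictMono.range_inj (hmono c) ((hmono d).comp (Fin.cast_strictMono hl))).1 ?_
    rw [Set.range_comp, (finCongr hl).surjective.range_eq (f := Fin.cast hl), Set.image_univ]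
    ext x
    constructor
    · rintro ⟨i, rfl⟩
      obtain ⟨j, hj⟩ := key h i
      exact ⟨j, htop hj⟩
    · rintro ⟨i, rfl⟩
      obtain ⟨j, hj⟩ := key h.symm i
      exact ⟨j, htop hj⟩
  refine eq_of_part_eq hl fun i => ?_
  obtain ⟨j, hj⟩ := key h i
  have : d.top j = d.top (Fin.cast hl i) := (htop hj).trans (congrFun htops i)
  rw [← hj, (hmono d).injective this]

lemma toFinpartition_surjective :
    Function.Surjective (toFinpartition : OrderedFinpartition n → _) := by
  intro π
  let S : Finset (Fin n) := {a | ∀ b ∈ π.part a, b ≤ a}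
  let g : Fin S.card ↪o Fin n := S.orderEmbOfFin rfl
  have hmem : ∀ x, x ∈ π.part x := fun x => π.mem_part (Finset.mem_univ x)
  have hpart : ∀ x, π.part x ∈ π.parts := fun x => π.part_mem.2 (Finset.mem_univ x)
  have hpos : ∀ x, 0 < (π.part x).card := fun x => Finset.card_pos.2 ⟨x, hmem x⟩
  have hg : ∀ i, ∀ b ∈ π.part (g i), b ≤ g i := fun i => by
    have : g i ∈ S := S.orderEmbOfFin_mem rfl i
    simpa [S] using this
  have hgS : ∀ x, (∀ b ∈ π.part x, b ≤ x) → ∃ i, g i = x := fun x hx => by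
    have : x ∈ Set.range g := by
      rw [Finset.range_orderEmbOfFin]
      simpa [S] using hx
    exact this
  have hexists : ∀ x, ∃ i, π.part (g i) = π.part x := fun x => by
    have hM := Finset.max'_mem (π.part x) ⟨x, hmem x⟩
    have hpM := π.part_eq_of_mem (hpart x) hM
    obtain ⟨i, hi⟩ := hgS ((π.part x).max' ⟨x, hmem x⟩) fun b hb =>
      Finset.le_max' _ _ (hpM ▸ hb)
    exact ⟨i, by rw [hi, hpM]⟩
  let c : OrderedFinpartition n :=
    { length := S.card
      partSize := fun i => (π.part (g i)).card
      partSize_pos := fun i => hpos _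
      emb := fun i => (π.part (g i)).orderEmbOfFin rfl
      emb_strictMono := fun i => OrderEmbedding.strictMono _
      parts_strictMono := by
        intro i j hij
        have key : ∀ i, (π.part (g i)).orderEmbOfFin rfl
            ⟨(π.part (g i)).card - 1, Nat.sub_one_lt_of_lt (hpos _)⟩ = g i := fun i => by
          rw [Finset.orderEmbOfFin_last rfl (hpos _)]
          exact le_antisymm (hg i _ (Finset.max'_mem _ _)) (Finset.le_max' _ _ (hmem _))
        beta_reduce
        rw [key, key]
        exact g.strictMono hij
      disjoint := by
        intro i _ j _ hij
        simp only [Function.onFun, Finset.range_orderEmbOfFin]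
        refine Set.disjoint_left.2 fun x hi hj => hij (g.injective ?_)
        have h1 := π.part_eq_of_mem (hpart _) hi
        have h2 := π.part_eq_of_mem (hpart _) hj
        have h3 : π.part (g i) = π.part (g j) := h1.symm.trans h2
        exact le_antisymm (hg j _ (h3 ▸ hmem _)) (hg i _ (h3 ▸ hmem _))
      cover := fun x => by
        obtain ⟨i, hi⟩ := hexists x
        refine ⟨i, ?_⟩
        rw [Finset.range_orderEmbOfFin, hi]
        exact hmem x }
  have hc : ∀ i : Fin S.card, c.part i = π.part (g i) := fun i => by
    rw [← Finset.coe_inj, coe_part]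
    exact Finset.range_orderEmbOfFin _ rfl
  refine ⟨c, Finpartition.ext (Finset.ext fun s => ?_)⟩
  rw [mem_toFinpartition_parts]
  constructor
  · rintro ⟨i, rfl⟩
    rw [hc]
    exact hpart _
  · intro hs
    obtain ⟨x, hx⟩ := π.nonempty_of_mem_parts hs
    obtain ⟨i, hi⟩ := hexists x
    exact ⟨i, (hc i).trans (hi.trans (π.part_eq_of_mem hs hx))⟩

lemma toFinpartition_bijective :
    Function.Bijective (toFinpartition : OrderedFinpartition n → _) :=
  ⟨toFinpartition_injective, toFinpartition_surjective⟩

/-- The parts of an ordered finpartition are the parts of the underlying partition. -/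
noncomputable def equivParts (c : OrderedFinpartition n) :
    Fin c.length ≃ {A // A ∈ c.toFinpartition.parts} :=
  Equiv.ofBijective (fun i => ⟨c.part i, (c.mem_toFinpartition_parts _).2 ⟨i, rfl⟩⟩)
    ⟨fun _ _ h => c.part_injective (congrArg Subtype.val h), fun A => by
      obtain ⟨i, hi⟩ := (c.mem_toFinpartition_parts _).1 A.2
      exact ⟨i, Subtype.ext hi⟩⟩

lemma card_equivParts (c : OrderedFinpartition n) (i : Fin c.length) :
    (c.equivParts i).1.card = c.partSize i :=
  c.card_part i

end OrderedFinpartition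

section Symmetric

open scoped ContDiff

variable {E G : Type*} [NormedAddCommGroup E] [NormedSpace ℝ E] [NormedAddCommGroup G]
  [NormedSpace ℝ G] {f : E → G}

lemma ContDiff.iteratedFDeriv_succ_apply (hf : ContDiff ℝ ∞ f) (n : ℕ) (x : E)
    (v : Fin (n + 1) → E) :
    iteratedFDeriv ℝ (n + 1) f x v =
      fderiv ℝ (fun y => iteratedFDeriv ℝ n f y (Fin.tail v)) x (v 0) := by
  have hd : DifferentiableAt ℝ (iteratedFDeriv ℝ n f) x :=
    (hf.differentiable_iteratedFDeriv (by exact_mod_cast ENat.natCast_lt_top n)) x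
  rw [fderiv_continuousMultilinear_apply_const_apply hd, iteratedFDeriv_succ_apply_left]

lemma ContDiff.iteratedFDeriv_comp_swap (hf : ContDiff ℝ ∞ f) (n : ℕ) (i : Fin n) (x : E)
    (v : Fin (n + 1) → E) :
    iteratedFDeriv ℝ (n + 1) f x (v ∘ Equiv.swap i.castSucc i.succ) =
      iteratedFDeriv ℝ (n + 1) f x v := by
  induction n generalizing x with
  | zero => exact i.elim0
  | succ n ih =>
    cases i using Fin.cases with
    | zero =>
      have hn : ContDiff ℝ 2 (iteratedFDeriv ℝ n f) :=
        (contDiff_infty.1 hf (2 + n)).iteratedFDeriv_right (by norm_cast)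
      have hsymm := (hn.contDiffAt (x := x)).isSymmSndFDerivAt (by simp)
      have key : ∀ w : Fin (n + 2) → E, iteratedFDeriv ℝ (n + 2) f x w =
          fderiv ℝ (fderiv ℝ (iteratedFDeriv ℝ n f)) x (w 0) (w 1) (Fin.tail (Fin.tail w)) := by
        intro w
        have hd : DifferentiableAt ℝ (fderiv ℝ (iteratedFDeriv ℝ n f)) x :=
          (hn.fderiv_right (m := 1) (by norm_num)).differentiable (by simp) x
        rw [hf.iteratedFDeriv_succ_apply]
        simp only [iteratedFDeriv_succ_apply_left]
        have h1 : DifferentiableAt ℝ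
            (fun y => fderiv ℝ (iteratedFDeriv ℝ n f) y (Fin.tail w 0)) x :=
          hd.clm_apply (differentiableAt_const _)
        rw [fderiv_continuousMultilinear_apply_const_apply h1,
          fderiv_clm_apply hd (differentiableAt_const _)]
        simp [Fin.tail]
      rw [key, key, hsymm.eq]
      have e : Fin.tail (Fin.tail (v ∘ Equiv.swap (Fin.castSucc 0) (Fin.succ 0))) =
          Fin.tail (Fin.tail v) := by
        funext j
        simp only [Fin.tail, Function.comp_apply]
        rw [Equiv.swap_apply_of_ne_of_ne] <;> simp [Fin.ext_iff]
      rw [e]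
      simp
    | succ j =>
      rw [hf.iteratedFDeriv_succ_apply, hf.iteratedFDeriv_succ_apply]
      have e : Fin.tail (v ∘ Equiv.swap j.succ.castSucc j.succ.succ) =
          Fin.tail v ∘ Equiv.swap j.castSucc j.succ := by
        funext k
        simp only [Fin.tail, Function.comp_apply, Equiv.swap_apply_def, Fin.ext_iff,
          Fin.val_succ, Fin.val_castSucc]
        split_ifs <;> first | rfl | omega
      have e0 : (v ∘ Equiv.swap j.succ.castSucc j.succ.succ) 0 = v 0 := by
        simp only [Function.comp_apply]
        rw [Equiv.swap_apply_of_ne_of_ne] <;> simp [Fin.ext_iff]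
      rw [e, e0]
      simp only [ih]

lemma ContDiff.iteratedFDeriv_comp_perm (hf : ContDiff ℝ ∞ f) (n : ℕ) (x : E) (v : Fin n → E)
    (σ : Equiv.Perm (Fin n)) :
    iteratedFDeriv ℝ n f x (v ∘ σ) = iteratedFDeriv ℝ n f x v := by
  cases n with
  | zero => rw [Subsingleton.elim (v ∘ σ) v]
  | succ n =>
    have hσ : σ ∈ Submonoid.closure
        (Set.range fun i : Fin n => Equiv.swap i.castSucc i.succ) := by
      rw [Equiv.Perm.mclosure_swap_castSucc_succ]
      trivial
    induction hσ using Submonoid.closure_induction generalizing v with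
    | mem σ h =>
      obtain ⟨i, rfl⟩ := h
      exact hf.iteratedFDeriv_comp_swap n i x v
    | one => rfl
    | mul σ τ _ _ hσ hτ =>
      rw [Equiv.Perm.coe_mul, ← Function.comp_assoc, hτ, hσ]

lemma ContDiff.iteratedFDeriv_comp_equiv (hf : ContDiff ℝ ∞ f) {n m : ℕ} (x : E)
    (v : Fin m → E) (σ : Fin n ≃ Fin m) :
    iteratedFDeriv ℝ n f x (v ∘ σ) = iteratedFDeriv ℝ m f x v := by
  obtain rfl : n = m := by simpa using Fintype.card_congr σ
  exact hf.iteratedFDeriv_comp_perm n x v σ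

end Symmetric

section BoundedMeasurable

open scoped ContDiff

variable {Ω : Type*} [MeasurableSpace Ω]

/-- Bounded measurable real-valued functions. -/
structure IsBoundedMeasurable (f : Ω → ℝ) : Prop where
  measurable : Measurable f
  bounded : ∃ C, ∀ z, |f z| ≤ C

namespace IsBoundedMeasurable

lemma const (a : ℝ) : IsBoundedMeasurable (fun _ : Ω => a) :=
  ⟨measurable_const, |a|, fun _ => le_rfl⟩

lemma add {f g : Ω → ℝ} (hf : IsBoundedMeasurable f) (hg : IsBoundedMeasurable g) :
    IsBoundedMeasurable (fun z => f z + g z) := by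
  obtain ⟨C, hC⟩ := hf.bounded
  obtain ⟨D, hD⟩ := hg.bounded
  exact ⟨hf.measurable.add hg.measurable, C + D, fun z =>
    (abs_add_le _ _).trans (add_le_add (hC z) (hD z))⟩

lemma mul {f g : Ω → ℝ} (hf : IsBoundedMeasurable f) (hg : IsBoundedMeasurable g) :
    IsBoundedMeasurable (fun z => f z * g z) := by
  obtain ⟨C, hC⟩ := hf.bounded
  obtain ⟨D, hD⟩ := hg.bounded
  refine ⟨hf.measurable.mul hg.measurable, C * D, fun z => ?_⟩
  rw [abs_mul]
  exact mul_le_mul (hC z) (hD z) (abs_nonneg _) ((abs_nonneg _).trans (hC z))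

lemma sum {ι : Type*} (s : Finset ι) {f : ι → Ω → ℝ} (hf : ∀ i, IsBoundedMeasurable (f i)) :
    IsBoundedMeasurable (fun z => ∑ i ∈ s, f i z) := by
  classical
  induction s using Finset.induction_on with
  | empty => simpa using const (0 : ℝ)
  | insert i s hi ih => simpa only [Finset.sum_insert hi] using (hf i).add ih

lemma prod {ι : Type*} (s : Finset ι) {f : ι → Ω → ℝ} (hf : ∀ i, IsBoundedMeasurable (f i)) :
    IsBoundedMeasurable (fun z => ∏ i ∈ s, f i z) := by
  classical
  induction s using Finset.induction_on with
  | empty => simpa using const (1 : ℝ)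
  | insert i s hi ih => simpa only [Finset.prod_insert hi] using (hf i).mul ih

lemma exp {f : Ω → ℝ} (hf : IsBoundedMeasurable f) :
    IsBoundedMeasurable (fun z => Real.exp (f z)) := by
  obtain ⟨C, hC⟩ := hf.bounded
  refine ⟨hf.measurable.exp, Real.exp C, fun z => ?_⟩
  rw [Real.abs_exp]
  exact Real.exp_le_exp.2 ((le_abs_self _).trans (hC z))

lemma integrable {f : Ω → ℝ} (hf : IsBoundedMeasurable f) (μ : Measure Ω) [IsFiniteMeasure μ] :
    Integrable f μ := by
  obtain ⟨C, hC⟩ := hf.bounded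
  exact Integrable.of_bound hf.measurable.aestronglyMeasurable C (.of_forall hC)

end IsBoundedMeasurable

variable {ι : Type*} [Fintype ι]

/-- The integral of `g` weighted by the exponential of a linear combination of the `Y j`. -/
noncomputable def weightedMGF (μ : Measure Ω) (Y : ι → Ω → ℝ) (g : Ω → ℝ) (s : ι → ℝ) : ℝ :=
  ∫ z, g z * Real.exp (∑ j, s j * Y j z) ∂μ

variable {μ : Measure Ω} [IsProbabilityMeasure μ] {Y : ι → Ω → ℝ}

lemma isBoundedMeasurable_weightedMGF_integrand (hY : ∀ j, IsBoundedMeasurable (Y j))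
    {g : Ω → ℝ} (hg : IsBoundedMeasurable g) (s : ι → ℝ) :
    IsBoundedMeasurable (fun z => g z * Real.exp (∑ j, s j * Y j z)) :=
  hg.mul (IsBoundedMeasurable.sum _ fun j => (IsBoundedMeasurable.const (s j)).mul (hY j)).exp

lemma integrable_sum_smul {E : Type*} [NormedAddCommGroup E] [NormedSpace ℝ E] {ν : Measure Ω}
    {f : ι → Ω → ℝ} (hf : ∀ j, Integrable (f j) ν) (P : ι → E) :
    Integrable (fun z => ∑ j, f j z • P j) ν :=
  integrable_finsetSum _ fun j _ => (hf j).smul_const _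

lemma integral_sum_smul {E : Type*} [NormedAddCommGroup E] [NormedSpace ℝ E] [CompleteSpace E]
    {ν : Measure Ω} {f : ι → Ω → ℝ} (hf : ∀ j, Integrable (f j) ν) (P : ι → E) :
    ∫ z, ∑ j, f j z • P j ∂ν = ∑ j, (∫ z, f j z ∂ν) • P j := by
  rw [integral_finsetSum _ fun j _ => (hf j).smul_const _]
  exact Finset.sum_congr rfl fun j _ => integral_smul_const _ _

lemma hasFDerivAt_weightedMGF (hY : ∀ j, IsBoundedMeasurable (Y j)) {g : Ω → ℝ}
    (hg : IsBoundedMeasurable g) (s : ι → ℝ) :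
    HasFDerivAt (weightedMGF μ Y g)
      (∑ j, weightedMGF μ Y (fun z => g z * Y j z) s •
        (ContinuousLinearMap.proj j : (ι → ℝ) →L[ℝ] ℝ)) s := by
  classical
  choose C hC using fun j => (hY j).bounded
  have hbm := fun j => isBoundedMeasurable_weightedMGF_integrand hY (hg.mul (hY j))
  obtain ⟨P, hP⟩ : ∃ P : ι → (ι → ℝ) →L[ℝ] ℝ, ∀ j, P j = ContinuousLinearMap.proj j :=
    ⟨_, fun _ => rfl⟩
  simp only [← hP]
  obtain ⟨F', hF'⟩ : ∃ F' : (ι → ℝ) → Ω → (ι → ℝ) →L[ℝ] ℝ, ∀ x z,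
      F' x z = ∑ j, (g z * Y j z * Real.exp (∑ j, x j * Y j z)) • P j := ⟨_, fun _ _ => rfl⟩
  have hint := fun j => (hbm j s).integrable μ
  have hF'int : Integrable (F' s) μ := by
    rw [funext (hF' s)]
    exact integrable_sum_smul hint P
  have hF's : ∫ z, F' s z ∂μ = ∑ j, weightedMGF μ Y (fun z => g z * Y j z) s • P j := by
    rw [funext (hF' s)]
    exact integral_sum_smul hint P
  have hbound : ∀ z, ∀ x ∈ Metric.ball s 1, ‖F' x z‖ ≤
      ∑ j, |g z * Y j z| * Real.exp (∑ j, (|s j| + 1) * C j) * ‖P j‖ := by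
    intro z x hx
    rw [hF']
    refine (norm_sum_le _ _).trans (Finset.sum_le_sum fun j _ => ?_)
    rw [norm_smul, norm_mul, Real.norm_eq_abs, Real.norm_eq_abs, Real.abs_exp]
    refine mul_le_mul_of_nonneg_right (mul_le_mul_of_nonneg_left (Real.exp_le_exp.2
      (Finset.sum_le_sum fun k _ => ?_)) (abs_nonneg _)) (norm_nonneg _)
    have hx' : |x k| ≤ |s k| + 1 := by
      have h1 : |x k - s k| ≤ 1 :=
        (norm_le_pi_norm (x - s) k).trans (mem_ball_iff_norm.1 hx).le
      have := abs_add_le (s k) (x k - s k)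
      rw [add_sub_cancel] at this
      linarith
    calc x k * Y k z ≤ |x k| * |Y k z| := (le_abs_self _).trans (abs_mul _ _).le
      _ ≤ (|s k| + 1) * C k := mul_le_mul hx' (hC k z) (abs_nonneg _) (by positivity)
  have hdiff : ∀ z, ∀ x ∈ Metric.ball s 1,
      HasFDerivAt (fun x => g z * Real.exp (∑ j, x j * Y j z)) (F' x z) x := by
    intro z x _
    have h1 : HasFDerivAt (fun x : ι → ℝ => ∑ j, x j * Y j z) (∑ j, Y j z • P j) x :=
      HasFDerivAt.fun_sum fun j _ => by
        rw [hP]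
        exact (hasFDerivAt_apply j x).mul_const (Y j z)
    refine (h1.exp.const_mul (g z)).congr_fderiv ?_
    rw [hF', Finset.smul_sum, Finset.smul_sum]
    refine Finset.sum_congr rfl fun j _ => ?_
    rw [smul_smul, smul_smul]
    congr 1
    ring
  have hbi : Integrable (fun z =>
      ∑ j, |g z * Y j z| * Real.exp (∑ j, (|s j| + 1) * C j) * ‖P j‖) μ :=
    integrable_finsetSum _ fun j _ =>
      ((((hg.mul (hY j)).integrable μ).abs).mul_const _).mul_const _
  refine HasFDerivAt.congr_fderiv ?_ hF's
  exact hasFDerivAt_integral_of_dominated_of_fderiv_le (Metric.ball_mem_nhds s one_pos)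
    (.of_forall fun x =>
      (isBoundedMeasurable_weightedMGF_integrand hY hg x).measurable.aestronglyMeasurable)
    ((isBoundedMeasurable_weightedMGF_integrand hY hg s).integrable μ)
    hF'int.aestronglyMeasurable (.of_forall hbound) hbi (.of_forall hdiff)

lemma contDiff_weightedMGF (hY : ∀ j, IsBoundedMeasurable (Y j)) {g : Ω → ℝ}
    (hg : IsBoundedMeasurable g) : ContDiff ℝ ∞ (weightedMGF μ Y g) := by
  refine contDiff_infty.2 fun n => ?_
  induction n generalizing g with
  | zero =>
    exact contDiff_zero.2 (continuous_iff_continuousAt.2 fun s =>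
      (hasFDerivAt_weightedMGF hY hg s).continuousAt)
  | succ n ih =>
    exact contDiff_succ_iff_hasFDerivAt.2 ⟨_, ContDiff.sum fun j _ =>
      (ih (hg.mul (hY j))).smul contDiff_const, fun s => hasFDerivAt_weightedMGF hY hg s⟩

lemma iteratedFDeriv_weightedMGF (hY : ∀ j, IsBoundedMeasurable (Y j)) {g : Ω → ℝ}
    (hg : IsBoundedMeasurable g) (n : ℕ) (s : ι → ℝ) (v : Fin n → ι → ℝ) :
    iteratedFDeriv ℝ n (weightedMGF μ Y g) s v =
      weightedMGF μ Y (fun z => g z * ∏ i, ∑ j, v i j * Y j z) s := by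
  induction n generalizing s with
  | zero => simp
  | succ n ih =>
    have hlin : ∀ w : ι → ℝ, IsBoundedMeasurable (fun z => ∑ j, w j * Y j z) := fun w =>
      IsBoundedMeasurable.sum _ fun j => (IsBoundedMeasurable.const (w j)).mul (hY j)
    have hprod := hg.mul (IsBoundedMeasurable.prod Finset.univ fun i => hlin (Fin.tail v i))
    rw [(contDiff_weightedMGF hY hg).iteratedFDeriv_succ_apply]
    simp only [ih]
    rw [(hasFDerivAt_weightedMGF hY hprod s).fderiv]
    simp only [_root_.sum_apply, _root_.smul_apply,
      ContinuousLinearMap.proj_apply, smul_eq_mul, weightedMGF]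
    rw [← Finset.sum_congr rfl fun j _ => integral_mul_const (v 0 j) _, ← integral_finsetSum]
    · refine integral_congr_ae (.of_forall fun z => ?_)
      simp only [Fin.prod_univ_succ, Fin.tail, Finset.sum_mul, Finset.mul_sum]
      exact Finset.sum_congr rfl fun j _ => by ring
    · exact fun j _ =>
        ((isBoundedMeasurable_weightedMGF_integrand hY (hprod.mul (hY j)) s).integrable μ).mul_const _

lemma weightedMGF_pos (hY : ∀ j, IsBoundedMeasurable (Y j)) (s : ι → ℝ) :
    0 < weightedMGF μ Y (fun _ => 1) s := by
  have h := (isBoundedMeasurable_weightedMGF_integrand hY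
    (IsBoundedMeasurable.const 1) s).integrable μ
  simp only [weightedMGF, one_mul] at h ⊢
  exact integral_exp_pos h

end BoundedMeasurable

section Cumulants

open ProbabilityTheory
open scoped ContDiff

variable {Ω : Type*} [MeasurableSpace Ω] {μ : Measure Ω} [IsProbabilityMeasure μ] {X : Ω → ℝ}

lemma IsBoundedMeasurable.pow {f : Ω → ℝ} (hf : IsBoundedMeasurable f) (n : ℕ) :
    IsBoundedMeasurable (fun z => f z ^ n) := by
  simpa using IsBoundedMeasurable.prod (Finset.univ : Finset (Fin n)) fun _ => hf

lemma IsBoundedMeasurable.integrableExpSet_eq_univ (hX : IsBoundedMeasurable X) :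
    integrableExpSet X μ = Set.univ :=
  Set.eq_univ_of_forall fun t => ((IsBoundedMeasurable.const t).mul hX).exp.integrable μ

lemma contDiffAt_mgf_zero (hX : IsBoundedMeasurable X) : ContDiffAt ℝ ∞ (mgf X μ) 0 :=
  (analyticAt_mgf (by simp [hX.integrableExpSet_eq_univ])).contDiffAt

lemma iteratedDeriv_mgf_zero_of_bounded (hX : IsBoundedMeasurable X) (n : ℕ) :
    iteratedDeriv n (mgf X μ) 0 = ∫ z, X z ^ n ∂μ :=
  iteratedDeriv_mgf_zero (by simp [hX.integrableExpSet_eq_univ]) n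

lemma cumulant_eq_sum_moments (hX : IsBoundedMeasurable X) (n : ℕ) :
    cumulant μ X n = ∑ c : OrderedFinpartition n,
      (∏ i, ∫ z, X z ^ c.partSize i ∂μ) * iteratedDeriv c.length Real.log 1 := by
  change iteratedDeriv n (Real.log ∘ mgf X μ) 0 = _
  rw [iteratedDeriv_scomp_eq_sum_orderedFinpartition (n := ∞) (Real.contDiffAt_log.2 (by simp))
    (contDiffAt_mgf_zero hX) (by exact_mod_cast le_top)]
  simp [iteratedDeriv_mgf_zero_of_bounded hX]

lemma moment_eq_sum_cumulants (hX : IsBoundedMeasurable X) (n : ℕ) :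
    ∫ z, X z ^ n ∂μ = ∑ c : OrderedFinpartition n, ∏ i, cumulant μ X (c.partSize i) := by
  have hpos : ∀ t, 0 < mgf X μ t := fun t =>
    mgf_pos (((IsBoundedMeasurable.const t).mul hX).exp.integrable μ)
  have h : mgf X μ = Real.exp ∘ (Real.log ∘ mgf X μ) :=
    funext fun t => (Real.exp_log (hpos t)).symm
  rw [← iteratedDeriv_mgf_zero_of_bounded hX, h,
    iteratedDeriv_scomp_eq_sum_orderedFinpartition (n := ∞) Real.contDiff_exp.contDiffAt
      (f := Real.log ∘ mgf X μ) ((contDiffAt_mgf_zero hX).log (hpos 0).ne')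
      (by exact_mod_cast le_top)]
  refine Finset.sum_congr rfl fun c _ => ?_
  simp only [iteratedDeriv_eq_iterate, Real.iter_deriv_exp]
  simp [cumulant, mgf, Function.comp_def, iteratedDeriv_eq_iterate]

variable {Ω' : Type*} [MeasurableSpace Ω']

lemma IsBoundedMeasurable.comp_prodMk {X : Ω' × Ω → ℝ} (hX : IsBoundedMeasurable X) (a : Ω') :
    IsBoundedMeasurable (fun b => X (a, b)) := by
  obtain ⟨C, hC⟩ := hX.bounded
  exact ⟨hX.measurable.comp measurable_prodMk_left, C, fun b => hC (a, b)⟩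

lemma IsBoundedMeasurable.integral_prod_right {X : Ω' × Ω → ℝ} (hX : IsBoundedMeasurable X) :
    IsBoundedMeasurable (fun a => ∫ b, X (a, b) ∂μ) := by
  obtain ⟨C, hC⟩ := hX.bounded
  refine ⟨hX.measurable.stronglyMeasurable.integral_prod_right'.measurable, C, fun a => ?_⟩
  simpa using norm_integral_le_of_norm_le_const (f := fun b => X (a, b)) (μ := μ)
    (.of_forall fun b => hC (a, b))

lemma isBoundedMeasurable_cumulant {X : Ω' × Ω → ℝ} (hX : IsBoundedMeasurable X) (n : ℕ) :
    IsBoundedMeasurable (fun a => cumulant μ (fun b => X (a, b)) n) := by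
  simp only [fun a => cumulant_eq_sum_moments (μ := μ) (hX.comp_prodMk a)]
  exact .sum _ fun c => (IsBoundedMeasurable.prod _ fun i =>
    (hX.pow (c.partSize i)).integral_prod_right).mul (.const _)

end Cumulants

section JointCumulants

open scoped ContDiff

variable {Ω : Type*} [MeasurableSpace Ω] {μ : Measure Ω} [IsProbabilityMeasure μ]
  {κ : Type*} [Fintype κ] {Y : κ → Ω → ℝ}

lemma contDiff_log_weightedMGF (hY : ∀ j, IsBoundedMeasurable (Y j)) :
    ContDiff ℝ ∞ (fun s => Real.log (weightedMGF μ Y (fun _ => 1) s)) :=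
  (contDiff_weightedMGF hY (.const 1)).log fun s => (weightedMGF_pos hY s).ne'

lemma jointCumulant_comp [DecidableEq κ] (hY : ∀ j, IsBoundedMeasurable (Y j)) {ι : Type*}
    [Fintype ι] [DecidableEq ι] (f : ι → κ) :
    jointCumulant μ (fun A => Y (f A)) = iteratedFDeriv ℝ (Fintype.card ι)
      (fun s => Real.log (weightedMGF μ Y (fun _ => 1) s)) 0
      (fun k => Pi.single (f ((Fintype.equivFin ι).symm k)) 1) := by
  let L : (ι → ℝ) →L[ℝ] (κ → ℝ) := ∑ A, (ContinuousLinearMap.proj A).smulRight (Pi.single (f A) 1)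
  have hL : ∀ u, L u = ∑ A, u A • Pi.single (f A) 1 := fun u => by simp [L]
  have hcomp : (fun t : ι → ℝ => Real.log (∫ z, Real.exp (∑ A, t A * Y (f A) z) ∂μ)) =
      (fun s => Real.log (weightedMGF μ Y (fun _ => 1) s)) ∘ L := by
    funext t
    simp only [Function.comp_apply, weightedMGF, one_mul, hL, Finset.sum_apply, Pi.smul_apply,
      smul_eq_mul, Finset.sum_mul]
    congr 2 with z
    rw [Finset.sum_comm]
    simp [Pi.single_apply]
  rw [jointCumulant, hcomp,
    L.iteratedFDeriv_comp_right (contDiff_log_weightedMGF hY) _ (by exact_mod_cast le_top)]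
  simp only [ContinuousMultilinearMap.compContinuousLinearMap_apply, map_zero]
  congr 1 with k : 1
  simp [hL, Pi.single_apply]

lemma jointCumulant_toFinpartition [DecidableEq κ] (hY : ∀ j, IsBoundedMeasurable (Y j)) {m : ℕ}
    (c : OrderedFinpartition m) (f : ℕ → κ) :
    jointCumulant μ (fun A : {A // A ∈ c.toFinpartition.parts} => Y (f A.1.card)) =
      iteratedFDeriv ℝ c.length (fun s => Real.log (weightedMGF μ Y (fun _ => 1) s)) 0
        (fun i => Pi.single (f (c.partSize i)) 1) := by
  rw [jointCumulant_comp hY (fun A : {A // A ∈ c.toFinpartition.parts} => f A.1.card),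
    ← (contDiff_log_weightedMGF hY).iteratedFDeriv_comp_equiv 0 _
      (c.equivParts.trans (Fintype.equivFin _))]
  congr 1 with i : 1
  simp [OrderedFinpartition.card_equivParts]

end JointCumulants

/-- The curve `t ↦ (t ^ j / j!)_j`, with the constant coordinate removed. -/
noncomputable def momentCurve (m : ℕ) (t : ℝ) (j : Fin (m + 1)) : ℝ :=
  (t ^ j.val - 0 ^ j.val) / (j.val.factorial : ℝ)

lemma momentCurve_zero (m : ℕ) : momentCurve m 0 = 0 := by
  funext j
  simp [momentCurve]

open scoped ContDiff in
lemma contDiff_momentCurve (m : ℕ) : ContDiff ℝ ∞ (momentCurve m) :=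
  contDiff_pi.2 fun _ => ((contDiff_id.pow _).sub contDiff_const).div_const _

lemma iteratedDeriv_momentCurve {m n : ℕ} (hn : n ≠ 0) (hnm : n ≤ m) :
    iteratedDeriv n (momentCurve m) 0 = Pi.single (Fin.ofNat (m + 1) n) 1 := by
  funext j
  have h : iteratedDeriv n (momentCurve m) 0 j =
      iteratedDeriv n (fun t => momentCurve m t j) 0 := by
    have := (ContinuousLinearMap.proj (R := ℝ)
      (φ := fun _ : Fin (m + 1) => ℝ) j).iteratedFDeriv_comp_left
        ((contDiff_momentCurve m).contDiffAt (x := 0)) (i := n) (by exact_mod_cast le_top)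
    rw [iteratedDeriv_eq_iteratedFDeriv, iteratedDeriv_eq_iteratedFDeriv]
    exact (congrArg (fun p => p fun _ => 1) this).symm
  rw [h]
  simp only [momentCurve]
  rw [iteratedDeriv_div_const, iteratedDeriv_fun_sub (by fun_prop) (by fun_prop),
    iteratedDeriv_const, iteratedDeriv_fun_pow_zero, if_neg hn, sub_zero, Pi.single_apply]
  have hiff : j = Fin.ofNat (m + 1) n ↔ n = j.val := by
    rw [Fin.ext_iff, Fin.val_ofNat, Nat.mod_eq_of_lt (Nat.lt_succ_of_le hnm), eq_comm]
  simp only [hiff]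
  split_ifs
  · simp [Nat.factorial_ne_zero]
  · simp

lemma OrderedFinpartition.partSize_le_self {n : ℕ} (c : OrderedFinpartition n)
    (i : Fin c.length) : c.partSize i ≤ n := by
  rw [← c.card_part]
  simpa using (c.part i).card_le_univ

section CompMomentCurve

open scoped ContDiff

variable {G : Type*} [NormedAddCommGroup G] [NormedSpace ℝ G]

lemma iteratedDeriv_comp_momentCurve {m n : ℕ} (hnm : n ≤ m) {F : (Fin (m + 1) → ℝ) → G}
    (hF : ContDiff ℝ ∞ F) :
    iteratedDeriv n (F ∘ momentCurve m) 0 = ∑ c : OrderedFinpartition n,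
      iteratedFDeriv ℝ c.length F 0
        (fun i => Pi.single (Fin.ofNat (m + 1) (c.partSize i)) 1) := by
  rw [iteratedDeriv_vcomp_eq_sum_orderedFinpartition (n := ∞) hF.contDiffAt
    (contDiff_momentCurve m).contDiffAt (by exact_mod_cast le_top)]
  simp only [momentCurve_zero]
  refine Finset.sum_congr rfl fun c _ => ?_
  congr 1 with i : 1
  exact iteratedDeriv_momentCurve (c.partSize_pos i).ne' ((c.partSize_le_self i).trans hnm)

end CompMomentCurve

lemma iteratedDeriv_log_comp_congr {A B : ℝ → ℝ} (m : ℕ) (hA : ContDiffAt ℝ m A 0)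
    (hB : ContDiffAt ℝ m B 0) (hA0 : A 0 ≠ 0)
    (hAB : ∀ n ≤ m, iteratedDeriv n A 0 = iteratedDeriv n B 0) :
    iteratedDeriv m (Real.log ∘ A) 0 = iteratedDeriv m (Real.log ∘ B) 0 := by
  have h0 : A 0 = B 0 := by simpa using hAB 0 m.zero_le
  rw [iteratedDeriv_scomp_eq_sum_orderedFinpartition (Real.contDiffAt_log.2 hA0) hA le_rfl,
    iteratedDeriv_scomp_eq_sum_orderedFinpartition (Real.contDiffAt_log.2 (h0 ▸ hA0)) hB le_rfl,
    h0]
  simp only [fun (c : OrderedFinpartition m) i => hAB _ (c.partSize_le_self i)]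

/-- Law of total cumulance on a product probability space `(Ω₁ × Ω₂, P₁ ⊗ P₂)`:
for a bounded random variable `X` and `m ≥ 2`,
`κ^m[X] = ∑_{π ⊢ {1,…,m}} κ₁^{#π}[ (κ₂^{#A}[X])_{A ∈ π} ]`. -/
theorem law_of_total_cumulance
    {Ω₁ Ω₂ : Type*} [MeasurableSpace Ω₁] [MeasurableSpace Ω₂]
    (μ₁ : Measure Ω₁) (μ₂ : Measure Ω₂) [IsProbabilityMeasure μ₁] [IsProbabilityMeasure μ₂]
    (X : Ω₁ × Ω₂ → ℝ) (hmeas : Measurable X) (C : ℝ) (hbdd : ∀ p, |X p| ≤ C)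
    (m : ℕ) (hm : 2 ≤ m) :
    cumulant (μ₁.prod μ₂) X m =
      ∑ π : Finpartition (Finset.univ : Finset (Fin m)),
        jointCumulant μ₁
          (fun A : {A // A ∈ π.parts} => fun ω₁ =>
            cumulant μ₂ (fun ω₂ => X (ω₁, ω₂)) A.1.card) := by
  have hX : IsBoundedMeasurable X := ⟨hmeas, C, hbdd⟩
  obtain ⟨Y, hYdef⟩ : ∃ Y : Fin (m + 1) → Ω₁ → ℝ, ∀ n ≤ m, Y (Fin.ofNat (m + 1) n) =
      fun a => cumulant μ₂ (fun b => X (a, b)) n :=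
    ⟨fun j a => cumulant μ₂ (fun b => X (a, b)) j, fun n hn => by
      simp [Nat.mod_eq_of_lt (Nat.lt_succ_of_le hn)]⟩
  have hY : ∀ j, IsBoundedMeasurable (Y j) := fun j => by
    have := hYdef j (Nat.lt_succ_iff.1 j.isLt)
    rw [Fin.ofNat_val_eq_self] at this
    exact this ▸ isBoundedMeasurable_cumulant hX j
  have hF := contDiff_weightedMGF (μ := μ₁) hY (.const 1)
  have hmoment : ∀ n ≤ m, iteratedDeriv n (ProbabilityTheory.mgf X (μ₁.prod μ₂)) 0 =
      iteratedDeriv n (weightedMGF μ₁ Y (fun _ => 1) ∘ momentCurve m) 0 := by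
    intro n hn
    rw [iteratedDeriv_mgf_zero_of_bounded hX, iteratedDeriv_comp_momentCurve hn hF,
      integral_prod _ ((hX.pow n).integrable _)]
    simp only [fun a => moment_eq_sum_cumulants (μ := μ₂) (hX.comp_prodMk a)]
    rw [integral_finsetSum _ fun c _ => (IsBoundedMeasurable.prod _ fun i =>
      isBoundedMeasurable_cumulant hX (c.partSize i)).integrable μ₁]
    refine Finset.sum_congr rfl fun c _ => ?_
    rw [iteratedFDeriv_weightedMGF hY (.const 1)]
    simp only [weightedMGF, one_mul, Pi.single_apply, ite_mul, zero_mul, Finset.sum_ite_eq',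
      Finset.mem_univ, if_true, Pi.zero_apply, Finset.sum_const_zero, Real.exp_zero, mul_one,
      fun i => hYdef _ ((c.partSize_le_self i).trans hn)]
  calc cumulant (μ₁.prod μ₂) X m
    _ = iteratedDeriv m (Real.log ∘ ProbabilityTheory.mgf X (μ₁.prod μ₂)) 0 := rfl
    _ = iteratedDeriv m (Real.log ∘ (weightedMGF μ₁ Y (fun _ => 1) ∘ momentCurve m)) 0 :=
      iteratedDeriv_log_comp_congr m ((contDiffAt_mgf_zero hX).of_le (by exact_mod_cast le_top))
        ((hF.comp (contDiff_momentCurve m)).contDiffAt.of_le (by exact_mod_cast le_top))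
        (by simp) hmoment
    _ = ∑ c : OrderedFinpartition m, iteratedFDeriv ℝ c.length
          (fun s => Real.log (weightedMGF μ₁ Y (fun _ => 1) s)) 0
          (fun i => Pi.single (Fin.ofNat (m + 1) (c.partSize i)) 1) :=
      iteratedDeriv_comp_momentCurve le_rfl (contDiff_log_weightedMGF hY)
    _ = ∑ c : OrderedFinpartition m, jointCumulant μ₁
          (fun A : {A // A ∈ c.toFinpartition.parts} => fun a =>
            cumulant μ₂ (fun b => X (a, b)) A.1.card) := by
      refine Finset.sum_congr rfl fun c _ => ?_
      rw [← jointCumulant_toFinpartition hY c (Fin.ofNat (m + 1))]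
      congr 1 with A : 1
      exact hYdef _ (by simpa using A.1.card_le_univ)
    _ = _ := OrderedFinpartition.toFinpartition_bijective.sum_comp
      fun π : Finpartition (Finset.univ : Finset (Fin m)) => jointCumulant μ₁
        (fun A : {A // A ∈ π.parts} => fun a => cumulant μ₂ (fun b => X (a, b)) A.1.card)
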